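/- Let L n be the number of λ-terms of natural size n. Then (L n : ℝ) · ρⁿ · n^{3/2} tends, as n → ∞, to the constant C = √(ρ·(3 + 2ρ + 3ρ²)/(1 − ρ)) / (4·ρ·√π). (Numerically C ≈ 0.60676 and 1/ρ ≈ 3.38298, so L n ∼ (3.38298…)ⁿ · C · n^{−3/2}.) -/

import Mathlib

inductive Term : Type
  | idx : ℕ → Term
  | app : Term → Term → Term
  | abs : Term → Term

def Term.size : Term → ℕ
  | .idx n => n + 1
  | .app t u => t.size + u.size + 1
  | .abs t => t.size + 1

noncomputable def L (n : ℕ) : ℕ := Nat.card {t : Term // t.size = n}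

open Filter Topology PowerSeries Finset

namespace Term

/-- A term of size `n + 1` is an index, an abstraction or an application. -/
def sizeSuccEquiv (n : ℕ) : {t : Term // t.size = n + 1} ≃
    (Unit ⊕ {t : Term // t.size = n}) ⊕
      (Σ p : antidiagonal n, {t : Term // t.size = p.1.1} × {t : Term // t.size = p.1.2}) where
  toFun
    | ⟨.idx _, _⟩ => .inl (.inl ())
    | ⟨.abs t, h⟩ => .inl (.inr ⟨t, by simpa [size] using h⟩)
    | ⟨.app t u, h⟩ =>
      .inr ⟨⟨(t.size, u.size), by simpa [size] using h⟩, ⟨t, rfl⟩, ⟨u, rfl⟩⟩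
  invFun
    | .inl (.inl _) => ⟨.idx n, rfl⟩
    | .inl (.inr t) => ⟨.abs t.1, by simp [size, t.2]⟩
    | .inr ⟨p, t, u⟩ => ⟨.app t.1 u.1, by
      simpa only [size, t.2, u.2, Nat.add_right_cancel_iff] using mem_antidiagonal.1 p.2⟩
  left_inv := by
    rintro ⟨t | t | t, h⟩
    · obtain rfl : t = n := by simpa [size] using h
      rfl
    · rfl
    · rfl
  right_inv := by
    rintro ((_ | t) | ⟨⟨⟨i, j⟩, hp⟩, ⟨t, ht⟩, ⟨u, hu⟩⟩)
    · rfl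
    · rfl
    · dsimp only at ht hu
      subst ht hu
      rfl

theorem size_pos (t : Term) : 0 < t.size := by cases t <;> simp [size]

instance isEmpty_size_zero : IsEmpty {t : Term // t.size = 0} :=
  ⟨fun t => t.1.size_pos.ne' t.2⟩

instance finite_size (n : ℕ) : Finite {t : Term // t.size = n} := by
  induction n using Nat.strong_induction_on with
  | _ n ih =>
    cases n with
    | zero => infer_instance
    | succ n =>
      have := ih n n.lt_succ_self
      have (p : antidiagonal n) :
          Finite ({t : Term // t.size = p.1.1} × {t : Term // t.size = p.1.2}) := by
        have hp := mem_antidiagonal.1 p.2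
        have := ih p.1.1 (by omega)
        have := ih p.1.2 (by omega)
        infer_instance
      exact Finite.of_equiv _ (sizeSuccEquiv n).symm

end Term

theorem L_zero : L 0 = 0 := by simp [L]

theorem L_succ (n : ℕ) :
    L (n + 1) = 1 + L n + ∑ p ∈ antidiagonal n, L p.1 * L p.2 := by
  rw [L, Nat.card_congr (Term.sizeSuccEquiv n), Nat.card_sum, Nat.card_sum, Nat.card_sigma]
  simp only [Nat.card_prod, Nat.card_unique]
  rw [← sum_coe_sort (antidiagonal n) fun p => L p.1 * L p.2]
  rfl

/-- The generating function of `λ`-terms by natural size. -/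
noncomputable def termSeries : PowerSeries ℂ := mk fun n => (L n : ℂ)

theorem termSeries_eq :
    termSeries = X * PowerSeries.mk 1 + X * termSeries + X * termSeries ^ 2 := by
  ext n
  cases n with
  | zero => simp [termSeries, L_zero]
  | succ n =>
    simp only [map_add, coeff_succ_X_mul]
    simp [pow_two, coeff_mul, termSeries, L_succ]

/-- The power series of `√(1 - X)`. -/
noncomputable def sqrtOneSub : PowerSeries ℂ :=
  1 - C (1 / 2) * (X * rescale (1 / 4) (catalanSeries.map (Nat.castRingHom ℂ)))

theorem sqrtOneSub_sq : sqrtOneSub ^ 2 = 1 - X := by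
  have h := congrArg (fun f => rescale (1 / 4 : ℂ) (f.map (Nat.castRingHom ℂ)))
    catalanSeries_sq_mul_X_add_one
  simp only [map_add, map_mul, map_pow, map_one, map_X, rescale_X] at h
  have h4 : (C (1 / 4) : PowerSeries ℂ) = C (1 / 2) ^ 2 := by
    rw [← map_pow]; norm_num
  have h1 : 4 * (C (1 / 2) : PowerSeries ℂ) ^ 2 = 1 := by
    rw [← map_pow, ← map_ofNat (C (R := ℂ)), ← map_mul, ← map_one C]; norm_num
  have h2 : 2 * (C (1 / 2) : PowerSeries ℂ) = 1 := by
    rw [← map_ofNat (C (R := ℂ)), ← map_mul, ← map_one C]; norm_num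
  rw [h4] at h
  rw [sqrtOneSub]
  generalize rescale (1 / 4) (catalanSeries.map (Nat.castRingHom ℂ)) = c at *
  generalize (C (1 / 2) : PowerSeries ℂ) = d at *
  linear_combination X * h - X * c * h2

theorem coeff_zero_sqrtOneSub : coeff 0 sqrtOneSub = 1 := by simp [sqrtOneSub]

theorem coeff_succ_sqrtOneSub (n : ℕ) :
    coeff (n + 1) sqrtOneSub = ((-(catalan n / (2 * 4 ^ n)) : ℝ) : ℂ) := by
  simp [sqrtOneSub, coeff_succ_X_mul, coeff_one, catalanSeries]
  field_simp

theorem catalan_le_four_pow (n : ℕ) : catalan n ≤ 4 ^ n :=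
  (Nat.le_mul_of_pos_left _ n.succ_pos).trans
    ((succ_mul_catalan_eq_centralBinom n).trans_le n.centralBinom_le_four_pow)

theorem norm_coeff_sqrtOneSub_le (n : ℕ) : ‖coeff n sqrtOneSub‖ ≤ 1 := by
  cases n with
  | zero => simp [coeff_zero_sqrtOneSub]
  | succ n =>
    have h : (catalan n : ℝ) ≤ 4 ^ n := mod_cast catalan_le_four_pow n
    rw [coeff_succ_sqrtOneSub, Complex.norm_real, norm_neg, Real.norm_of_nonneg (by positivity),
      div_le_one (by positivity)]
    linarith [show (0 : ℝ) < 4 ^ n by positivity]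

theorem catalan_div_four_pow_eq (n : ℕ) :
    (catalan n / 4 ^ n : ℝ) = √(1 / ((n + 1) ^ 2 * (2 * n + 1) * Real.Wallis.W n)) := by
  have h : ((n + 1 : ℝ) * catalan n) * (n.factorial : ℝ) ^ 2 = (2 * n).factorial := by
    have h1 := Nat.choose_mul_factorial_mul_factorial (show n ≤ 2 * n by omega)
    rw [← Nat.centralBinom_eq_two_mul_choose, ← succ_mul_catalan_eq_centralBinom,
      show 2 * n - n = n by omega] at h1
    rw [← h1]
    push_cast
    ring
  rw [eq_comm, Real.sqrt_eq_iff_mul_self_eq (by have := Real.Wallis.W_pos n; positivity)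
    (by positivity), Real.Wallis.W_eq_factorial_ratio, ← h]
  have hc : (catalan n : ℝ) ≠ 0 := by
    intro h0
    rw [h0] at h
    simp at h
    exact Nat.factorial_ne_zero _ (by exact_mod_cast h.symm)
  have := n.factorial_ne_zero
  have h16 : (2 : ℝ) ^ (4 * n) = (4 ^ n) ^ 4 / (4 ^ n) ^ 2 := by
    rw [eq_div_iff (by positivity), ← pow_mul, ← pow_mul, show (4 : ℝ) = 2 ^ 2 by norm_num,
      ← pow_mul, ← pow_mul, ← pow_add]
    ring_nf
  rw [h16]
  field_simp

/-- The weight `(n + 1) ^ (3 / 2)`. -/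
noncomputable def threeHalvesWeight (n : ℕ) : ℝ := √((n + 1) ^ 3)

theorem threeHalvesWeight_pos (n : ℕ) : 0 < threeHalvesWeight n := by
  unfold threeHalvesWeight; positivity

theorem threeHalvesWeight_add_le (m k : ℕ) :
    threeHalvesWeight (m + k) ≤ threeHalvesWeight m * threeHalvesWeight k := by
  rw [threeHalvesWeight, threeHalvesWeight, threeHalvesWeight, ← Real.sqrt_mul (by positivity),
    ← mul_pow]
  gcongr
  push_cast
  nlinarith [show (0 : ℝ) ≤ m * k by positivity]

theorem threeHalvesWeight_le (n : ℕ) : threeHalvesWeight n ≤ (n + 1) ^ 2 := by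
  rw [threeHalvesWeight]
  refine Real.sqrt_le_iff.2 ⟨by positivity, ?_⟩
  rw [← pow_mul]
  exact pow_le_pow_right₀ (by linarith [n.cast_nonneg (α := ℝ)]) (by norm_num)

theorem tendsto_sqrt_ratio (a b : ℝ) :
    Tendsto (fun n : ℕ => √((n + a) ^ 3) / √((n + b) ^ 3)) atTop (𝓝 1) := by
  have h1 : Tendsto (fun n : ℕ => √(((a + 1 * n) / (b + 1 * n)) ^ 3)) atTop (𝓝 √((1 / 1) ^ 3)) :=
    ((tendsto_add_mul_div_add_mul_atTop_nhds a b 1 one_ne_zero).pow 3).sqrt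
  simp only [div_one, one_pow, Real.sqrt_one] at h1
  refine h1.congr' ?_
  filter_upwards [eventually_ge_atTop ⌈-b⌉₊] with n hn
  have : -b ≤ n := Nat.ceil_le.1 hn
  rw [div_pow, Real.sqrt_div' _ (pow_nonneg (by linarith) 3)]
  ring_nf

theorem tendsto_weight_mul_coeff_sqrtOneSub :
    Tendsto (fun n => (threeHalvesWeight n : ℂ) * coeff n sqrtOneSub) atTop
      (𝓝 ((-(1 / (2 * √Real.pi)) : ℝ) : ℂ)) := by
  rw [← tendsto_add_atTop_iff_nat 1]
  have h1 := (tendsto_add_mul_div_add_mul_atTop_nhds 2 1 (1 : ℝ) one_ne_zero).pow 2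
  have h2 := tendsto_add_mul_div_add_mul_atTop_nhds 2 1 (1 : ℝ) two_ne_zero
  have h3 := ((h1.mul h2).div Real.Wallis.tendsto_W_nhds_pi_div_two
    (by positivity)).sqrt.const_mul (-(1 / 2))
  have hlim : -(1 / 2) * √((1 / 1) ^ 2 * (1 / 2) / (Real.pi / 2)) = -(1 / (2 * √Real.pi)) := by
    rw [show ((1 / 1) ^ 2 * (1 / 2) / (Real.pi / 2) : ℝ) = 1 / Real.pi by field_simp,
      Real.sqrt_div zero_le_one, Real.sqrt_one]
    field_simp
  rw [hlim] at h3
  refine ((Complex.continuous_ofReal.tendsto _).comp h3).congr fun n => ?_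
  have hW := Real.Wallis.W_pos n
  rw [coeff_succ_sqrtOneSub, ← Complex.ofReal_mul, Function.comp_apply, Complex.ofReal_inj,
    mul_comm (2 : ℝ), ← div_div, catalan_div_four_pow_eq, mul_neg, mul_div_assoc',
    threeHalvesWeight, ← Real.sqrt_mul (by positivity), neg_mul,
    one_div_mul_eq_div, Pi.div_apply]
  congr 3
  push_cast
  field_simp
  ring

/-- If `w` is submultiplicative and `w n * a n` converges, then so does `w n` times the
convolution of `a` with a sequence `b` that is summable against `w`. -/
theorem tendsto_weight_mul_sum_antidiagonal {w : ℕ → ℝ} (hw : ∀ n, 0 < w n)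
    (hmul : ∀ m k, w (m + k) ≤ w m * w k)
    (hratio : ∀ k, Tendsto (fun m => w (m + k) / w m) atTop (𝓝 1))
    {a b : ℕ → ℂ} {c : ℂ} (ha : Tendsto (fun n => (w n : ℂ) * a n) atTop (𝓝 c))
    (hb : Summable fun k => ‖b k‖ * w k) :
    Tendsto (fun n => (w n : ℂ) * ∑ p ∈ antidiagonal n, b p.1 * a p.2) atTop
      (𝓝 ((∑' k, b k) * c)) := by
  obtain ⟨M, hM⟩ := ha.norm.bddAbove_range
  have hM' (n : ℕ) : w n * ‖a n‖ ≤ M := by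
    have := hM ⟨n, rfl⟩
    simpa [abs_of_pos (hw n)] using this
  have hM0 : 0 ≤ M := (mul_nonneg (hw 0).le (norm_nonneg _)).trans (hM' 0)
  let f (n k : ℕ) : ℂ := if k ≤ n then w n * (b k * a (n - k)) else 0
  have key : Tendsto (fun n => ∑' k, f n k) atTop (𝓝 (∑' k, b k * c)) := by
    refine tendsto_tsum_of_dominated_convergence (hb.mul_right M) (fun k => ?_)
      (Eventually.of_forall fun n k => ?_)
    · rw [← tendsto_add_atTop_iff_nat k]
      have h1 := ((Complex.continuous_ofReal.tendsto _).comp (hratio k)).mul ha |>.const_mul (b k)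
      simp only [Complex.ofReal_one, one_mul] at h1
      refine h1.congr fun m => ?_
      have : (w m : ℂ) ≠ 0 := by exact_mod_cast (hw m).ne'
      simp [f]
      field_simp
    · by_cases hk : k ≤ n
      · simp only [f, hk, if_true, norm_mul, Complex.norm_real, Real.norm_of_nonneg (hw n).le]
        obtain ⟨m, rfl⟩ := Nat.exists_eq_add_of_le' hk
        rw [Nat.add_sub_cancel]
        calc w (m + k) * (‖b k‖ * ‖a m‖) ≤ w m * w k * (‖b k‖ * ‖a m‖) := by
              gcongr; exact hmul m k
          _ = ‖b k‖ * w k * (w m * ‖a m‖) := by ring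
          _ ≤ ‖b k‖ * w k * M := by
              gcongr
              · exact mul_nonneg (norm_nonneg _) (hw k).le
              · exact hM' m
      · simp only [f, hk, if_false, norm_zero]
        exact mul_nonneg (mul_nonneg (norm_nonneg _) (hw k).le) hM0
  rw [tsum_mul_right] at key
  refine key.congr fun n => ?_
  rw [Nat.sum_antidiagonal_eq_sum_range_succ_mk, mul_sum,
    tsum_eq_sum (s := range n.succ) fun k hk => by
      simp only [f]; rw [if_neg]; simpa using hk]
  exact sum_congr rfl fun k hk => by
    simp only [f]; rw [if_pos]; simpa [Nat.lt_succ_iff] using hk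

theorem norm_coeff_mul_le {f g : PowerSeries ℂ} {d : ℕ} (hf : ∀ n, ‖coeff n f‖ ≤ 1)
    (hg : ∀ n : ℕ, ‖coeff n g‖ ≤ (n + 1) ^ d) (n : ℕ) :
    ‖coeff n (f * g)‖ ≤ (n + 1) ^ (d + 1) := by
  rw [coeff_mul]
  calc _ ≤ ∑ p ∈ antidiagonal n, ‖coeff p.1 f * coeff p.2 g‖ := norm_sum_le _ _
    _ ≤ ∑ p ∈ antidiagonal n, ((n : ℝ) + 1) ^ d := by
      refine sum_le_sum fun p hp => ?_
      rw [norm_mul, ← one_mul (((n : ℝ) + 1) ^ d)]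
      refine mul_le_mul (hf _) ((hg _).trans ?_) (norm_nonneg _) zero_le_one
      have : p.2 ≤ n := by have := mem_antidiagonal.1 hp; omega
      gcongr
    _ = _ := by simp [pow_succ']

theorem norm_coeff_rescale_sqrtOneSub_le {u : ℂ} (hu : ‖u‖ ≤ 1) (n : ℕ) :
    ‖coeff n (rescale u sqrtOneSub)‖ ≤ 1 := by
  rw [coeff_rescale, norm_mul, norm_pow]
  exact mul_le_one₀ (pow_le_one₀ (norm_nonneg _) hu) (norm_nonneg _) (norm_coeff_sqrtOneSub_le n)

theorem coeff_mul_mul_pow_eq_sum (f g : PowerSeries ℂ) (z : ℂ) (n : ℕ) :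
    coeff n (f * g) * z ^ n =
      ∑ p ∈ antidiagonal n, coeff p.1 f * z ^ p.1 * (coeff p.2 g * z ^ p.2) := by
  rw [coeff_mul, sum_mul]
  refine sum_congr rfl fun p hp => ?_
  rw [← mem_antidiagonal.1 hp, pow_add]
  ring

theorem tsum_coeff_mul {f g : PowerSeries ℂ} {z : ℂ}
    (hf : Summable fun n => ‖coeff n f * z ^ n‖) (hg : Summable fun n => ‖coeff n g * z ^ n‖) :
    ∑' n, coeff n (f * g) * z ^ n =
      (∑' n, coeff n f * z ^ n) * ∑' n, coeff n g * z ^ n := by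
  rw [tsum_mul_tsum_eq_tsum_sum_antidiagonal_of_summable_norm hf hg]
  exact tsum_congr (coeff_mul_mul_pow_eq_sum f g z)

theorem rescale_sqrtOneSub_sq (u : ℂ) :
    rescale u sqrtOneSub ^ 2 = 1 - C u * X := by
  rw [← map_pow, sqrtOneSub_sq, map_sub, map_one, rescale_X]

theorem summable_coeff_mul_weight {g : PowerSeries ℂ} {d : ℕ}
    (hg : ∀ n : ℕ, ‖coeff n g‖ ≤ (n + 1) ^ d) {ρ : ℝ} (h0 : 0 < ρ) (h1 : ρ < 1) :
    Summable fun n => ‖coeff n g * (ρ : ℂ) ^ n‖ * threeHalvesWeight n := by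
  have h : Summable fun n : ℕ => ((n + 1 : ℕ) : ℝ) ^ (d + 2) * ρ ^ (n + 1) :=
    (summable_nat_add_iff (f := fun n : ℕ => (n : ℝ) ^ (d + 2) * ρ ^ n) 1).2
      (summable_pow_mul_geometric_of_norm_lt_one (d + 2)
        (by rwa [Real.norm_of_nonneg h0.le]))
  refine Summable.of_nonneg_of_le
    (fun n => mul_nonneg (norm_nonneg _) (threeHalvesWeight_pos n).le) (fun n => ?_)
    (h.mul_left ρ⁻¹)
  rw [norm_mul, norm_pow, Complex.norm_real, Real.norm_of_nonneg h0.le]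
  calc _ ≤ ((n : ℝ) + 1) ^ d * ρ ^ n * ((n : ℝ) + 1) ^ 2 := by
        gcongr
        · exact (threeHalvesWeight_pos n).le
        · exact hg n
        · exact threeHalvesWeight_le n
    _ = _ := by
        push_cast
        field_simp
        ring

theorem summable_norm_coeff_mul_pow {g : PowerSeries ℂ} {d : ℕ}
    (hg : ∀ n : ℕ, ‖coeff n g‖ ≤ (n + 1) ^ d) {ρ : ℝ} (h0 : 0 < ρ) (h1 : ρ < 1) :
    Summable fun n => ‖coeff n g * (ρ : ℂ) ^ n‖ := by
  refine (summable_coeff_mul_weight hg h0 h1).of_nonneg_of_le (fun n => norm_nonneg _) fun n =>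
    le_mul_of_one_le_right (norm_nonneg _) ?_
  rw [threeHalvesWeight, Real.one_le_sqrt]
  exact one_le_pow₀ (by linarith [n.cast_nonneg (α := ℝ)])

theorem coeff_one_sub_C_mul_X_eq_zero (u : ℂ) {n : ℕ} (hn : n ∉ range 2) :
    coeff n (1 - C u * X) = 0 := by
  have : ¬ n < 2 := by rwa [mem_range] at hn
  simp [coeff_one, coeff_X, show n ≠ 0 by omega, show n ≠ 1 by omega]

theorem summable_coeff_one_sub_C_mul_X (u z : ℂ) :
    Summable fun n => ‖coeff n (1 - C u * X) * z ^ n‖ :=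
  summable_of_ne_finset_zero (s := range 2) fun n hn => by
    rw [coeff_one_sub_C_mul_X_eq_zero u hn, zero_mul, norm_zero]

theorem tsum_coeff_one_sub_C_mul_X (u z : ℂ) :
    ∑' n, coeff n (1 - C u * X) * z ^ n = 1 - u * z := by
  rw [tsum_eq_sum (s := range 2) fun n hn => by
    rw [coeff_one_sub_C_mul_X_eq_zero u hn, zero_mul]]
  simp [sum_range_succ, coeff_one, coeff_X]
  ring

theorem mk_one_mul_one_sub : (PowerSeries.mk 1 : PowerSeries ℂ) * (1 - X) = 1 :=
  mk_one_mul_one_sub_eq_one ℂ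

/-- The power series of `√((1 - u X) (1 - v X) / (1 - X))`. -/
noncomputable def regularFactor (u v : ℂ) : PowerSeries ℂ :=
  rescale u sqrtOneSub * (rescale v sqrtOneSub * (rescale 1 sqrtOneSub * PowerSeries.mk 1))

theorem regularFactor_sq (u v : ℂ) :
    regularFactor u v ^ 2 = (1 - C u * X) * (1 - C v * X) * PowerSeries.mk 1 := by
  simp only [regularFactor, mul_pow, rescale_sqrtOneSub_sq, map_one]
  linear_combination (1 - C u * X) * (1 - C v * X) * PowerSeries.mk 1 * mk_one_mul_one_sub

theorem norm_coeff_regularFactor_le {u v : ℂ} (hu : ‖u‖ ≤ 1) (hv : ‖v‖ ≤ 1) (n : ℕ) :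
    ‖coeff n (regularFactor u v)‖ ≤ (n + 1) ^ 3 :=
  norm_coeff_mul_le (norm_coeff_rescale_sqrtOneSub_le hu)
    (norm_coeff_mul_le (norm_coeff_rescale_sqrtOneSub_le hv)
      (norm_coeff_mul_le (d := 0) (norm_coeff_rescale_sqrtOneSub_le (by simp)) (by simp))) n

theorem tsum_regularFactor_sq {u v : ℂ} (hu : ‖u‖ ≤ 1) (hv : ‖v‖ ≤ 1) {ρ : ℝ} (h0 : 0 < ρ)
    (h1 : ρ < 1) :
    (∑' n, coeff n (regularFactor u v) * (ρ : ℂ) ^ n) ^ 2 =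
      (1 - u * ρ) * (1 - v * ρ) / (1 - ρ) := by
  have hG := summable_norm_coeff_mul_pow (norm_coeff_regularFactor_le hu hv) h0 h1
  have hone : Summable fun n => ‖coeff n (PowerSeries.mk 1 : PowerSeries ℂ) * (ρ : ℂ) ^ n‖ :=
    summable_norm_coeff_mul_pow (d := 0) (by simp) h0 h1
  have hv' := summable_coeff_one_sub_C_mul_X v ρ
  have hprod : Summable fun n => ‖coeff n ((1 - C v * X) * PowerSeries.mk 1) * (ρ : ℂ) ^ n‖ := by
    refine (summable_norm_sum_mul_antidiagonal_of_summable_norm hv' hone).congr fun n => ?_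
    rw [coeff_mul_mul_pow_eq_sum]
  rw [pow_two, ← tsum_coeff_mul hG hG, ← pow_two, regularFactor_sq, mul_assoc,
    tsum_coeff_mul (summable_coeff_one_sub_C_mul_X u ρ) hprod, tsum_coeff_mul hv' hone,
    tsum_coeff_one_sub_C_mul_X, tsum_coeff_one_sub_C_mul_X]
  simp only [coeff_mk, Pi.one_apply, one_mul]
  rw [tsum_geometric_of_norm_lt_one (by simpa [abs_of_pos h0] using h1)]
  ring

theorem termSeries_factorization {r u v : ℂ} (h1 : r + u + v = 3)
    (h2 : r * u + r * v + u * v = -1) (h3 : r * u * v = 1) :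
    1 - X - 2 * X * termSeries = rescale r sqrtOneSub * regularFactor u v := by
  have hsq : (1 - X - 2 * X * termSeries) ^ 2 =
      (rescale r sqrtOneSub * regularFactor u v) ^ 2 := by
    rw [mul_pow, rescale_sqrtOneSub_sq, regularFactor_sq]
    replace h1 := congrArg (C (R := ℂ)) h1
    replace h2 := congrArg (C (R := ℂ)) h2
    replace h3 := congrArg (C (R := ℂ)) h3
    simp only [map_add, map_mul, map_neg, map_one, map_ofNat] at h1 h2 h3
    have hm := mk_one_mul_one_sub
    have hL := termSeries_eq
    generalize (PowerSeries.mk 1 : PowerSeries ℂ) = H at *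
    linear_combination (-4 * X) * hL - (1 - X) ^ 2 * hm + X * H * h1 - X ^ 2 * H * h2
      + X ^ 3 * H * h3
  rcases sq_eq_sq_iff_eq_or_eq_neg.1 hsq with h | h
  · exact h
  · have h0 := congrArg constantCoeff h
    have hA : constantCoeff sqrtOneSub = 1 := by simp [sqrtOneSub]
    have hR (u : ℂ) : constantCoeff (rescale u sqrtOneSub) = 1 := by
      rw [← coeff_zero_eq_constantCoeff_apply, coeff_rescale, coeff_zero_sqrtOneSub]; simp
    simp [regularFactor, hR, hA] at h0
    norm_num at h0

theorem exists_roots {ρ : ℝ} (h0 : 0 < ρ) (h1 : ρ < 1) (hroot : ρ ^ 3 + ρ ^ 2 + 3 * ρ = 1) :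
    ∃ u v : ℂ, ‖u‖ ≤ 1 ∧ ‖v‖ ≤ 1 ∧ u + v = -(ρ + ρ ^ 2) ∧ u * v = ρ := by
  have hd : 0 ≤ 4 * ρ - (ρ + ρ ^ 2) ^ 2 := by
    have : ρ * (1 + ρ) ^ 2 ≤ 4 := by nlinarith
    nlinarith
  let u : ℂ := ⟨-(ρ + ρ ^ 2) / 2, √(4 * ρ - (ρ + ρ ^ 2) ^ 2) / 2⟩
  have hn : Complex.normSq u = ρ := by
    rw [Complex.normSq_mk]
    linear_combination (1 / 4) * Real.mul_self_sqrt hd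
  have hu : ‖u‖ ≤ 1 := by
    rw [← sq_le_one_iff₀ (norm_nonneg _), ← Complex.normSq_eq_norm_sq, hn]
    exact h1.le
  refine ⟨u, starRingEnd ℂ u, hu, by rwa [Complex.norm_conj], ?_, ?_⟩
  · rw [Complex.add_conj]
    simp only [u]
    push_cast
    ring
  · rw [Complex.mul_conj, hn]

theorem tendsto_weight_mul_coeff_termSeries {ρ : ℝ} (h0 : 0 < ρ) (h1 : ρ < 1) {u v : ℂ}
    (hu : ‖u‖ ≤ 1) (hv : ‖v‖ ≤ 1)
    (hfact : 1 - X - 2 * X * termSeries = rescale (ρ⁻¹ : ℂ) sqrtOneSub * regularFactor u v) :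
    Tendsto (fun n => ((L n * ρ ^ n * threeHalvesWeight (n + 1) : ℝ) : ℂ)) atTop
      (𝓝 ((∑' n, coeff n (regularFactor u v) * (ρ : ℂ) ^ n) / (4 * ρ * √Real.pi))) := by
  have hρ : (ρ : ℂ) ≠ 0 := by exact_mod_cast h0.ne'
  have hw (k : ℕ) : Tendsto (fun m => threeHalvesWeight (m + k) / threeHalvesWeight m) atTop
      (𝓝 1) := by
    refine (tendsto_sqrt_ratio (k + 1) 1).congr fun m => ?_
    simp only [threeHalvesWeight]
    push_cast
    ring_nf
  have key := tendsto_weight_mul_sum_antidiagonal threeHalvesWeight_pos threeHalvesWeight_add_le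
    hw tendsto_weight_mul_coeff_sqrtOneSub
    (summable_coeff_mul_weight (norm_coeff_regularFactor_le hu hv) h0 h1)
  rw [← tendsto_add_atTop_iff_nat 1] at key
  have hpi : (√Real.pi : ℂ) ≠ 0 := by
    exact_mod_cast (Real.sqrt_pos.2 Real.pi_pos).ne'
  have key2 := key.const_mul (-(1 / (2 * ρ)) : ℂ)
  have hlim : (-(1 / (2 * ρ)) : ℂ) * ((∑' n, coeff n (regularFactor u v) * (ρ : ℂ) ^ n) *
      ((-(1 / (2 * √Real.pi)) : ℝ) : ℂ)) =
      (∑' n, coeff n (regularFactor u v) * (ρ : ℂ) ^ n) / (4 * ρ * √Real.pi) := by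
    push_cast
    field_simp
    ring
  rw [hlim] at key2
  refine key2.congr' ?_
  filter_upwards [eventually_ge_atTop 1] with n hn
  obtain ⟨m, rfl⟩ := Nat.exists_eq_add_of_le' hn
  have hc := congrArg (coeff (m + 1 + 1)) hfact
  have hl : coeff (m + 1 + 1) (1 - X - 2 * X * termSeries) = -2 * (L (m + 1) : ℂ) := by
    rw [mul_assoc, ← map_ofNat (C (R := ℂ)), map_sub, map_sub, coeff_C_mul, coeff_succ_X_mul]
    simp [coeff_one, coeff_X, termSeries]
  have hr : ∑ p ∈ antidiagonal (m + 1 + 1),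
      coeff p.1 (regularFactor u v) * (ρ : ℂ) ^ p.1 * coeff p.2 sqrtOneSub =
      coeff (m + 1 + 1) (rescale (ρ⁻¹ : ℂ) sqrtOneSub * regularFactor u v) * ρ ^ (m + 1 + 1) := by
    rw [mul_comm (rescale _ _), coeff_mul, sum_mul]
    refine sum_congr rfl fun p hp => ?_
    rw [← mem_antidiagonal.1 hp, pow_add, coeff_rescale, inv_pow]
    field_simp
  rw [hr, ← hc, hl]
  push_cast
  field_simp
  ring

theorem L_asymptotics (ρ : ℝ) (hρ : ρ ∈ Set.Ioo (0 : ℝ) 1)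
    (hroot : ρ ^ 3 + ρ ^ 2 + 3 * ρ = 1) :
    Filter.Tendsto
      (fun n : ℕ => (L n : ℝ) * ρ ^ n * (n : ℝ) ^ ((3 : ℝ) / 2))
      Filter.atTop
      (nhds (Real.sqrt (ρ * (3 + 2 * ρ + 3 * ρ ^ 2) / (1 - ρ)) /
        (4 * ρ * Real.sqrt Real.pi))) := by
  obtain ⟨h0, h1⟩ := hρ
  obtain ⟨u, v, hu, hv, hadd, hmul⟩ := exists_roots h0 h1 hroot
  have hρ0 : (ρ : ℂ) ≠ 0 := by exact_mod_cast h0.ne'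
  have hrootC : (ρ : ℂ) ^ 3 + ρ ^ 2 + 3 * ρ = 1 := by exact_mod_cast hroot
  have hinv : (ρ⁻¹ : ℂ) = 3 + ρ + ρ ^ 2 := by
    rw [inv_eq_iff_eq_inv]
    exact eq_inv_of_mul_eq_one_left (by linear_combination hrootC)
  have hfact := termSeries_factorization (r := (ρ⁻¹ : ℂ)) (u := u) (v := v)
    (by linear_combination hinv + hadd)
    (by
      rw [hmul, ← mul_add, hadd]
      field_simp
      ring)
    (by rw [mul_assoc, hmul, inv_mul_cancel₀ hρ0])
  have hlim := tendsto_weight_mul_coeff_termSeries h0 h1 hu hv hfact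
  have hsq := tsum_regularFactor_sq hu hv h0 h1
  generalize (∑' n, coeff n (regularFactor u v) * (ρ : ℂ) ^ n) = g at hlim hsq
  have hsq' : g ^ 2 = ((ρ * (3 + 2 * ρ + 3 * ρ ^ 2) / (1 - ρ) : ℝ) : ℂ) := by
    rw [hsq]
    push_cast
    congr 1
    linear_combination (-ρ : ℂ) * hadd + (ρ : ℂ) ^ 2 * hmul - hrootC
  have hpi := Real.sqrt_pos.2 Real.pi_pos
  set c : ℝ := 4 * ρ * √Real.pi with hc
  have hc0 : 0 < c := by positivity
  have hgc : g / (4 * ρ * √Real.pi) = g / (c : ℂ) := by rw [hc]; push_cast; rfl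
  rw [hgc] at hlim
  have hre := (Complex.continuous_re.tendsto _).comp hlim
  have him := (Complex.continuous_im.tendsto _).comp hlim
  simp only [Function.comp_def, Complex.ofReal_re, Complex.ofReal_im, Complex.div_ofReal_re,
    Complex.div_ofReal_im] at hre him
  have hgim : g.im = 0 := by
    have := tendsto_nhds_unique him tendsto_const_nhds
    simpa [hc0.ne'] using this
  have hgre : 0 ≤ g.re := by
    have : 0 ≤ g.re / c := ge_of_tendsto' hre fun n =>
      mul_nonneg (by positivity) (threeHalvesWeight_pos _).le
    simpa [hc0.ne'] using mul_nonneg this hc0.le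
  have hg : g.re = √(ρ * (3 + 2 * ρ + 3 * ρ ^ 2) / (1 - ρ)) := by
    rw [← Real.sqrt_sq hgre]
    congr 1
    rw [← Complex.ofReal_inj, ← hsq']
    conv_rhs => rw [← Complex.re_add_im g, hgim]
    simp
  rw [← hg]
  have hfin := hre.mul (tendsto_sqrt_ratio 0 2)
  rw [mul_one] at hfin
  refine hfin.congr fun n => ?_
  have hw : threeHalvesWeight (n + 1) = √(((n : ℝ) + 2) ^ 3) := by
    rw [threeHalvesWeight]; push_cast; ring_nf
  have hw0 : √(((n : ℝ) + 2) ^ 3) ≠ 0 := by positivity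
  rw [hw, add_zero, mul_assoc, mul_div_cancel₀ _ hw0, Real.sqrt_eq_rpow,
    ← Real.rpow_natCast_mul n.cast_nonneg]
  norm_num
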